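/- Let Γ be a finite simple graph with clique number m (the largest size of a set of pairwise adjacent vertices). Then the cohomological dimension of A_Γ is at most m: for every integer k > m and every representation M of A_Γ on an abelian group (a ℤ-linear representation of A_Γ), the group cohomology H^k(A_Γ; M) is zero. -/

import Mathlib

/-- The commutator relators of a right-angled Artin group: one commutator
`v * w * v⁻¹ * w⁻¹` for each edge `{v, w}` of `Γ`. -/
def raagRels {V : Type} (Γ : SimpleGraph V) : Set (FreeGroup V) :=
  {r | ∃ v w : V, Γ.Adj v w ∧
    r = FreeGroup.of v * FreeGroup.of w * (FreeGroup.of v)⁻¹ * (FreeGroup.of w)⁻¹}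

/-- The right-angled Artin group of a (finite simple) graph `Γ`: the group presented
by the vertices of `Γ` with commutation relators for the edges. -/
abbrev RAAG {V : Type} (Γ : SimpleGraph V) : Type := PresentedGroup (raagRels Γ)

namespace RaagCohom

open CategoryTheory Limits

/-- Elementary criterion for the vanishing of group cohomology in positive degree. -/
lemma isZero_succ_of {k G : Type} [CommRing k] [Group G] (A : Rep k G) (n : ℕ)
    (h : ∀ f : (Fin (n + 1) → G) → A, inhomogeneousCochains.d A (n + 1) f = 0 →
      ∃ g : (Fin n → G) → A, inhomogeneousCochains.d A n g = f) :
    IsZero (groupCohomology A (n + 1)) := by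
  apply HomologicalComplex.ExactAt.isZero_homology
  rw [HomologicalComplex.exactAt_iff' _ n (n + 1) (n + 2) (by simp) (by simp)]
  rw [ShortComplex.moduleCat_exact_iff]
  intro x hx
  obtain ⟨g, hg⟩ := h x (by
    have h2 : ((groupCohomology.inhomogeneousCochains A).d (n + 1) (n + 2)).hom x = 0 := hx
    rw [groupCohomology.inhomogeneousCochains.d_def] at h2
    exact h2)
  refine ⟨g, ?_⟩
  change ((groupCohomology.inhomogeneousCochains A).d n (n + 1)).hom g = x
  rw [groupCohomology.inhomogeneousCochains.d_def]
  exact hg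

/-- Vanishing of `H¹` in terms of crossed homomorphisms. -/
lemma isZero_one_iff {k G : Type} [CommRing k] [Group G] (A : Rep k G) :
    IsZero (groupCohomology A 1) ↔
      ∀ f : G → A, (∀ g h, f (g * h) = A.ρ g (f h) + f g) → ∃ x : A, ∀ g, A.ρ g x - x = f g := by
  constructor
  · intro h f hf
    have hs : Subsingleton (groupCohomology A 1) := ModuleCat.subsingleton_of_isZero h
    have hf' : f ∈ groupCohomology.cocycles₁ A := (groupCohomology.mem_cocycles₁_iff f).2 hf
    have := (groupCohomology.H1π_eq_zero_iff (A := A) ⟨f, hf'⟩).1 (Subsingleton.elim _ _)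
    obtain ⟨x, hx⟩ := this
    exact ⟨x, fun g => congrFun hx g⟩
  · intro h
    have : Subsingleton (groupCohomology A 1) := by
      refine subsingleton_of_forall_eq 0 fun y => ?_
      induction y using groupCohomology.H1_induction_on with
      | h f =>
        rw [groupCohomology.H1π_eq_zero_iff]
        obtain ⟨x, hx⟩ := h f ((groupCohomology.mem_cocycles₁_iff f).1 f.2)
        exact ⟨x, funext hx⟩
    exact ModuleCat.isZero_of_subsingleton _

/-- The representation of `G` on all functions `G → M`, `(g φ)(x) = φ (x g)`. -/
def funRep (k : Type) [CommRing k] (G : Type) [Group G] (M : Type) [AddCommGroup M] [Module k M] :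
    Representation k G (G → M) where
  toFun g := LinearMap.funLeft k M (· * g)
  map_one' := by ext; simp [LinearMap.funLeft]
  map_mul' _ _ := by ext; simp [LinearMap.funLeft, mul_assoc]

lemma funRep_apply {k G : Type} [CommRing k] [Group G] {M : Type} [AddCommGroup M] [Module k M]
    (g : G) (φ : G → M) (x : G) : funRep k G M g φ x = φ (x * g) := rfl

lemma contractNth_zero_cons {H : Type} [Group H] {n : ℕ} (p : H) (h : Fin (n + 1) → H) :
    Fin.contractNth 0 (· * ·) (Fin.cons p h : Fin (n + 2) → H) =
      Fin.cons (p * h 0) (fun i => h i.succ) := by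
  ext i
  refine Fin.cases ?_ (fun i => ?_) i
  · simp [Fin.contractNth]
  · simp [Fin.contractNth]

lemma contractNth_succ_cons {H : Type} [Group H] {n : ℕ} (j : Fin (n + 1)) (p : H)
    (h : Fin (n + 1) → H) :
    Fin.contractNth j.succ (· * ·) (Fin.cons p h : Fin (n + 2) → H) =
      Fin.cons p (Fin.contractNth j (· * ·) h) := by
  ext i
  refine Fin.cases ?_ (fun i => ?_) i
  · simp [Fin.contractNth]
  · simp [Fin.contractNth]

lemma d_funRep_apply {k G H : Type} [CommRing k] [Group G] [Group H] (φ : H →* G)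
    (M : Type) [AddCommGroup M] [Module k M] (n : ℕ) (f : (Fin n → H) → G → M)
    (h : Fin (n + 1) → H) (x : G) :
    (inhomogeneousCochains.d (Rep.res φ (Rep.of (funRep k G M))) n f :
      (Fin (n + 1) → H) → G → M) h x =
      f (fun i => h i.succ) (x * φ (h 0)) +
        ∑ j : Fin (n + 1), (-1 : k) ^ ((j : ℕ) + 1) • f (Fin.contractNth j (· * ·) h) x := by
  have h1 := congrFun (inhomogeneousCochains.d_hom_apply
    (Rep.res φ (Rep.of (funRep k G M))) n f h) x
  refine h1.trans ?_
  refine congrArg (f (fun i => h i.succ) (x * φ (h 0)) + ·) ?_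
  exact (Finset.sum_apply x Finset.univ _)

/-- If `φ : H → G` has a retraction, `Fun(G, M)` is acyclic as a representation of `H`. -/
lemma funRep_acyclic {k G H : Type} [CommRing k] [Group G] [Group H] (φ : H →* G) (π : G →* H)
    (hπ : ∀ h, π (φ h) = h) (M : Type) [AddCommGroup M] [Module k M] (n : ℕ) :
    IsZero (groupCohomology (Rep.res φ (Rep.of (funRep k G M))) (n + 1)) := by
  apply isZero_succ_of
  intro (f : (Fin (n + 1) → H) → G → M) hf
  refine ⟨fun h x => f (Fin.cons (π x) h) (x * (φ (π x))⁻¹), ?_⟩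
  funext h
  funext x
  have key := congrFun (congrFun hf (Fin.cons (π x) h)) (x * (φ (π x))⁻¹)
  have key2 : _ = (0 : M) :=
    (d_funRep_apply (k := k) φ M (n + 1) f (Fin.cons (π x) h) (x * (φ (π x))⁻¹)).symm.trans key
  refine (d_funRep_apply (k := k) φ M n _ h x).trans ?_
  rw [Fin.sum_univ_succ] at key2
  simp only [contractNth_zero_cons, contractNth_succ_cons, Fin.cons_succ, Fin.cons_zero,
    inv_mul_cancel_right, Fin.val_zero, Fin.val_succ, zero_add, pow_one, map_mul, hπ,
    pow_succ (-1 : k) (_ + 1)] at key2 ⊢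
  have e : x * φ (h 0) * (φ (π x) * φ (h 0))⁻¹ = x * (φ (π x))⁻¹ := by group
  rw [e]
  simp only [mul_neg, mul_one, neg_smul, one_smul, Finset.sum_neg_distrib] at key2
  rw [← sub_eq_zero, ← neg_eq_zero, ← key2]
  abel

section Shift

variable {k G H : Type} [CommRing k] [Group G] [Group H]

/-- The embedding of `M` in `Fun(G, M)`. -/
noncomputable def emb (M : Rep k G) : M ⟶ Rep.of (funRep k G M.V) :=
  Rep.ofHom ⟨LinearMap.pi fun x => M.ρ x, fun g => by
    ext m x
    simp [funRep_apply]⟩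

lemma emb_apply (M : Rep k G) (m : M) (x : G) :
    ((emb M).hom m : G → M.V) x = M.ρ x m := rfl

/-- The short exact sequence `M → Fun(G, M) → M'`. -/
noncomputable def ses (M : Rep k G) : ShortComplex (Rep k G) :=
  ShortComplex.mk (emb M) (cokernel.π (emb M)) (cokernel.condition _)

lemma ses_shortExact (M : Rep k G) : (ses M).ShortExact where
  exact := ShortComplex.exact_cokernel _
  mono_f := by
    rw [Rep.mono_iff_injective]
    intro a b hab
    have h1 : M.ρ 1 a = M.ρ 1 b := congrFun (f := ((emb M).hom a : G → M.V)) hab 1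
    rw [map_one] at h1
    exact h1
  epi_g := inferInstanceAs (Epi (cokernel.π (emb M)))

lemma shift (φ : H →* G) (π : G →* H) (hπ : ∀ h, π (φ h) = h) (M : Rep k G) (n : ℕ) :
    IsZero (groupCohomology (Rep.res φ (ses M).X₃) (n + 1)) ↔
      IsZero (groupCohomology (Rep.res φ M) (n + 2)) := by
  have hS : ((ses M).map (Rep.resFunctor φ)).ShortExact :=
    (Rep.shortExact_res φ).2 (ses_shortExact M)
  have := groupCohomology.isIso_δ_of_isZero hS (n + 1)
    (funRep_acyclic φ π hπ M.V n) (funRep_acyclic φ π hπ M.V (n + 1))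
  exact (asIso (groupCohomology.δ hS (n + 1) (n + 1 + 1) rfl)).isZero_iff

lemma shift_id (M : Rep k G) (n : ℕ) :
    IsZero (groupCohomology (ses M).X₃ (n + 1)) ↔ IsZero (groupCohomology M (n + 2)) :=
  shift (MonoidHom.id G) (MonoidHom.id G) (fun _ => rfl) M n

lemma ses_acyclic (M : Rep k G) (n : ℕ) : IsZero (groupCohomology (ses M).X₂ (n + 1)) :=
  funRep_acyclic (k := k) (MonoidHom.id G) (MonoidHom.id _) (fun _ => rfl) M.V n

lemma ses_surj (M : Rep k G) (z : (ses M).X₃) : ∃ y : (ses M).X₂, (ses M).g.hom y = z :=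
  (Rep.epi_iff_surjective _).1 (ses_shortExact M).epi_g z

lemma ses_inj (M : Rep k G) : Function.Injective (ses M).f.hom :=
  (Rep.mono_iff_injective _).1 (ses_shortExact M).mono_f

lemma ses_exact (M : Rep k G) (y : (ses M).X₂) (hy : (ses M).g.hom y = 0) :
    ∃ m : M, (ses M).f.hom m = y := by
  have : LinearMap.range (ses M).f.hom.toLinearMap = LinearMap.ker (ses M).g.hom.toLinearMap :=
    ((ses_shortExact M).exact.map (forget₂ (Rep k G) (ModuleCat k))).moduleCat_range_eq_ker
  have h2 : y ∈ LinearMap.ker (ses M).g.hom.toLinearMap := hy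
  rw [← this] at h2
  exact h2

lemma ses_gf (M : Rep k G) (m : M) : (ses M).g.hom ((ses M).f.hom m) = 0 := by
  have : LinearMap.range (ses M).f.hom.toLinearMap = LinearMap.ker (ses M).g.hom.toLinearMap :=
    ((ses_shortExact M).exact.map (forget₂ (Rep k G) (ModuleCat k))).moduleCat_range_eq_ker
  have h2 : (ses M).f.hom m ∈ LinearMap.range (ses M).f.hom.toLinearMap := ⟨m, rfl⟩
  rw [this] at h2
  exact h2

/-- If `H¹(H, M) = 0` then `H`-invariants lift. -/
lemma lift_invariant (φ : H →* G) (M : Rep k G)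
    (h1 : IsZero (groupCohomology (Rep.res φ M) 1)) (z : (ses M).X₃)
    (hz : ∀ h, (ses M).X₃.ρ (φ h) z = z) :
    ∃ y : (ses M).X₂, (∀ h, (ses M).X₂.ρ (φ h) y = y) ∧ (ses M).g.hom y = z := by
  obtain ⟨y, hy⟩ := ses_surj M z
  have hex : ∀ h : H, ∃ m : M, (ses M).f.hom m = (ses M).X₂.ρ (φ h) y - y := fun h => by
    apply ses_exact
    rw [map_sub, Rep.hom_comm_apply, hy, hz, sub_self]
  choose x hx using hex
  obtain ⟨m, hm⟩ := (isZero_one_iff _).1 h1 x (fun g h => by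
    apply ses_inj M
    have e : (ses M).f.hom ((Rep.res φ M).ρ g (x h)) = (ses M).X₂.ρ (φ g) ((ses M).f.hom (x h)) :=
      Rep.hom_comm_apply _ _ _
    refine (hx _).trans (Eq.trans ?_ (map_add (ses M).f.hom _ _).symm)
    rw [e, hx, hx]
    simp)
  have hm' : ∀ h, M.ρ (φ h) m - m = x h := hm
  refine ⟨y - (ses M).f.hom m, fun h => ?_, ?_⟩
  · have h3 := hx h
    rw [← hm' h] at h3
    have h4 : (ses M).f.hom (M.ρ (φ h) m) - (ses M).f.hom m = (ses M).X₂.ρ (φ h) y - y :=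
      (map_sub (ses M).f.hom _ _).symm.trans h3
    have e : (ses M).f.hom (M.ρ (φ h) m) = (ses M).X₂.ρ (φ h) ((ses M).f.hom m) :=
      Rep.hom_comm_apply _ _ _
    rw [e] at h4
    rw [map_sub]
    rw [sub_eq_sub_iff_add_eq_add] at h4 ⊢
    rw [← h4, add_comm]
  · rw [map_sub, hy, ses_gf, sub_zero]

end Shift

lemma step {k G H L : Type} [CommRing k] [Group G] [Group H] [Group L]
    (φ : H →* G) (π : G →* H) (hπ : ∀ h, π (φ h) = h)
    (φ' : L →* G) (π' : G →* L) (hπ' : ∀ h, π' (φ' h) = h)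
    (hbase : ∀ M : Rep k G, IsZero (groupCohomology (Rep.res φ' M) 1) →
      IsZero (groupCohomology (Rep.res φ M) 2) → IsZero (groupCohomology M 2))
    (n : ℕ) : ∀ M : Rep k G, IsZero (groupCohomology (Rep.res φ' M) (n + 1)) →
      IsZero (groupCohomology (Rep.res φ M) (n + 2)) → IsZero (groupCohomology M (n + 2)) := by
  induction n with
  | zero => exact hbase
  | succ n ih =>
    intro M h1 h2
    exact (shift_id M (n + 1)).1 (ih _ ((shift φ' π' hπ' M n).2 h1) ((shift φ π hπ M (n + 1)).2 h2))

section Raag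

variable {V : Type} (Γ : SimpleGraph V) {k : Type} [CommRing k]

/-- The generators. -/
def gen (v : V) : RAAG Γ := PresentedGroup.of v

lemma gen_comm {v w : V} (h : Γ.Adj v w) : gen Γ v * gen Γ w = gen Γ w * gen Γ v := by
  have h1 : (PresentedGroup.mk (raagRels Γ)) (FreeGroup.of v * FreeGroup.of w *
      (FreeGroup.of v)⁻¹ * (FreeGroup.of w)⁻¹) = 1 :=
    PresentedGroup.one_of_mem ⟨v, w, h, rfl⟩
  simp only [map_mul, map_inv] at h1
  exact (mul_inv_eq_iff_eq_mul.1 (mul_inv_eq_one.1 h1))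

/-- The universal property. -/
def lift {X : Type} [Group X] (f : V → X) (hf : ∀ v w, Γ.Adj v w → f v * f w = f w * f v) :
    RAAG Γ →* X :=
  PresentedGroup.toGroup (f := f) (by
    rintro r ⟨v, w, h, rfl⟩
    simp [hf v w h])

@[simp] lemma lift_gen {X : Type} [Group X] (f : V → X)
    (hf : ∀ v w, Γ.Adj v w → f v * f w = f w * f v) (v : V) : lift Γ f hf (gen Γ v) = f v :=
  PresentedGroup.toGroup.of _

lemma mem_of_gen (K : Subgroup (RAAG Γ)) (h : ∀ v, gen Γ v ∈ K) (g : RAAG Γ) : g ∈ K :=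
  PresentedGroup.generated_by _ K h g

/-- Inclusion of the subgroup on a set of vertices. -/
def incl (S : Set V) : RAAG (Γ.induce S) →* RAAG Γ :=
  lift _ (fun v => gen Γ v.1) (fun _ _ h => gen_comm Γ h)

open Classical in
/-- Retraction to the subgroup on a set of vertices. -/
noncomputable def retr (S : Set V) : RAAG Γ →* RAAG (Γ.induce S) :=
  lift _ (fun v => if h : v ∈ S then gen (Γ.induce S) ⟨v, h⟩ else 1) (by
    intro v w h
    by_cases hv : v ∈ S <;> by_cases hw : w ∈ S <;> simp only [hv, hw, dite_true, dite_false,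
      mul_one, one_mul]
    exact gen_comm (Γ.induce S) (v := ⟨v, hv⟩) (w := ⟨w, hw⟩) h)

lemma incl_gen (S : Set V) (v : S) : incl Γ S (gen _ v) = gen Γ v.1 := lift_gen _ _ _ _

lemma retr_incl (S : Set V) (h : RAAG (Γ.induce S)) : retr Γ S (incl Γ S h) = h := by
  have : (retr Γ S).comp (incl Γ S) = MonoidHom.id _ := by
    apply PresentedGroup.ext
    intro v
    change retr Γ S (incl Γ S (gen _ v)) = gen _ v
    rw [incl_gen]
    simp [retr]
  exact DFunLike.congr_fun this h

/-- Existence of a crossed homomorphism supported at one vertex. -/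
lemma exists_crossed (A : Rep.{0} k (RAAG Γ)) (v : V) (m : A)
    (hm : ∀ w, Γ.Adj v w → A.ρ (gen Γ w) m = m) :
    ∃ D : RAAG Γ → A, (∀ g h, D (g * h) = A.ρ g (D h) + D g) ∧ D (gen Γ v) = m ∧
      ∀ w, w ≠ v → D (gen Γ w) = 0 := by
  classical
  let c : V → A := fun w => if w = v then m else 0
  let e : V → Equiv.Perm A := fun w =>
    { toFun := fun x => A.ρ (gen Γ w) x + c w
      invFun := fun x => A.ρ (gen Γ w)⁻¹ (x - c w)
      left_inv := fun x => by simp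
      right_inv := fun x => by simp }
  have he : ∀ w x, e w x = A.ρ (gen Γ w) x + c w := fun _ _ => rfl
  let F : RAAG Γ →* Equiv.Perm A := lift (X := Equiv.Perm A) Γ e (by
    intro a b hab
    refine Equiv.ext fun x => ?_
    simp only [Equiv.Perm.mul_apply, he, map_add]
    have h1 : A.ρ (gen Γ a) (A.ρ (gen Γ b) x) = A.ρ (gen Γ b) (A.ρ (gen Γ a) x) := by
      rw [← Module.End.mul_apply, ← Module.End.mul_apply, ← map_mul, ← map_mul, gen_comm Γ hab]
    have h2 : ∀ a b, Γ.Adj a b → A.ρ (gen Γ a) (c b) = c b := by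
      intro a b hab
      by_cases hb : b = v
      · subst hb
        simp [c, hm a hab.symm]
      · simp [c, hb]
    rw [h1, h2 a b hab, h2 b a hab.symm]
    abel)
  have hF : ∀ w x, F (gen Γ w) x = A.ρ (gen Γ w) x + c w := fun w x => by
    simp only [F, lift_gen, he]
  let K : Subgroup (RAAG Γ) :=
    { carrier := {g | ∀ x y, F g x - F g y = A.ρ g (x - y)}
      one_mem' := by simp
      mul_mem' := by
        intro a b ha hb x y
        have ha' := ha (F b x) (F b y)
        rw [hb x y] at ha'
        simp only [map_mul, Equiv.Perm.mul_apply, Module.End.mul_apply]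
        exact ha'
      inv_mem' := by
        intro a ha x y
        have ha' := ha (F a⁻¹ x) (F a⁻¹ y)
        have hc : ∀ x, F a (F a⁻¹ x) = x := fun x => by
          rw [← Equiv.Perm.mul_apply, ← map_mul, mul_inv_cancel, map_one, Equiv.Perm.one_apply]
        rw [hc, hc] at ha'
        rw [ha', Representation.inv_self_apply] }
  have hK : ∀ g x y, F g x - F g y = A.ρ g (x - y) := fun g =>
    mem_of_gen Γ K (fun w x y => by rw [hF, hF, map_sub]; abel) g
  refine ⟨fun g => F g 0, fun g h => ?_, ?_, ?_⟩
  · have := hK g (F h 0) 0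
    rw [sub_zero, sub_eq_iff_eq_add] at this
    change F (g * h) 0 = A.ρ g (F h 0) + F g 0
    rw [map_mul, Equiv.Perm.mul_apply, this]
  · change F (gen Γ v) 0 = m
    rw [hF]; simp [c]
  · intro w hw
    change F (gen Γ w) 0 = 0
    rw [hF]; simp [c, hw]

lemma crossed_ext (A : Rep.{0} k (RAAG Γ)) (D D' : RAAG Γ → A)
    (hD : ∀ g h, D (g * h) = A.ρ g (D h) + D g) (hD' : ∀ g h, D' (g * h) = A.ρ g (D' h) + D' g)
    (h : ∀ v, D (gen Γ v) = D' (gen Γ v)) (g : RAAG Γ) : D g = D' g := by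
  have one : D 1 = D' 1 := by
    have h1 := hD 1 1
    have h2 := hD' 1 1
    simp at h1 h2
    rw [h1, h2]
  let K : Subgroup (RAAG Γ) :=
    { carrier := {g | D g = D' g}
      one_mem' := one
      mul_mem' := by
        intro a b (ha : D a = D' a) (hb : D b = D' b)
        change D (a * b) = D' (a * b)
        rw [hD, hD', ha, hb]
      inv_mem' := by
        intro a (ha : D a = D' a)
        change D a⁻¹ = D' a⁻¹
        have h1 := hD a⁻¹ a
        have h2 := hD' a⁻¹ a
        rw [inv_mul_cancel] at h1 h2
        rw [h1, h2, ha] at one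
        exact add_left_cancel one }
  exact mem_of_gen Γ K h g

lemma base (v : V) (M : Rep k (RAAG Γ))
    (h1 : IsZero (groupCohomology (Rep.res (incl Γ {w | Γ.Adj v w}) M) 1))
    (h2 : IsZero (groupCohomology (Rep.res (incl Γ {w | w ≠ v}) M) 2)) :
    IsZero (groupCohomology M 2) := by
  rw [← shift_id M 0, zero_add, isZero_one_iff]
  rw [← shift _ _ (retr_incl Γ _) M 0, zero_add, isZero_one_iff] at h2
  intro d hd
  obtain ⟨z, hz⟩ := h2 (fun h => d (incl Γ _ h)) (fun g h => by rw [map_mul, hd]; rfl)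
  have hz' : ∀ w, w ≠ v → (ses M).X₃.ρ (gen Γ w) z - z = d (gen Γ w) := fun w hw => by
    rw [← incl_gen Γ {w | w ≠ v} ⟨w, hw⟩]
    exact hz _
  -- the modified crossed homomorphism
  let p : RAAG Γ → (ses M).X₃ := fun g => (ses M).X₃.ρ g z - z
  have hp : ∀ g h, p (g * h) = (ses M).X₃.ρ g (p h) + p g := fun g h => by simp [p]
  let d' : RAAG Γ → (ses M).X₃ := fun g => d g - p g
  have hd' : ∀ g h, d' (g * h) = (ses M).X₃.ρ g (d' h) + d' g := fun g h => by
    simp only [d', hp, hd, map_sub]; abel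
  have hd'0 : ∀ w, w ≠ v → d' (gen Γ w) = 0 := fun w hw => by
    simp only [d', p, hz' w hw, sub_self]
  have hinv : ∀ w, Γ.Adj v w → (ses M).X₃.ρ (gen Γ w) (d' (gen Γ v)) = d' (gen Γ v) := by
    intro w hw
    have e := congrArg d' (gen_comm Γ hw)
    rw [hd', hd', hd'0 w hw.ne', map_zero, zero_add, add_zero] at e
    exact e.symm
  have hinvL : ∀ l, (ses M).X₃.ρ (incl Γ {w | Γ.Adj v w} l) (d' (gen Γ v)) = d' (gen Γ v) := by
    let K : Subgroup (RAAG (Γ.induce {w | Γ.Adj v w})) :=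
      { carrier := {l | (ses M).X₃.ρ (incl Γ {w | Γ.Adj v w} l) (d' (gen Γ v)) = d' (gen Γ v)}
        one_mem' := by simp
        mul_mem' := by
          intro a b ha hb
          simp only [Set.mem_ofPred_eq] at ha hb ⊢
          rw [map_mul, map_mul, Module.End.mul_apply, hb, ha]
        inv_mem' := by
          intro a ha
          simp only [Set.mem_ofPred_eq] at ha ⊢
          conv_lhs => rw [← ha]
          rw [map_inv, Representation.inv_self_apply] }
    exact mem_of_gen _ K (fun w => by
      change (ses M).X₃.ρ (incl Γ _ (gen _ w)) _ = _
      rw [incl_gen]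
      exact hinv _ w.2)
  obtain ⟨y, hy, hyz⟩ := lift_invariant _ M h1 _ hinvL
  obtain ⟨D, hD, hDv, hD0⟩ := exists_crossed Γ (ses M).X₂ v y (fun w hw => by
    have := hy (gen _ ⟨w, hw⟩)
    rwa [incl_gen] at this)
  obtain ⟨u, hu⟩ := (isZero_one_iff (ses M).X₂).1
    (ses_acyclic M 0) D hD
  have hfin := crossed_ext Γ (ses M).X₃ (fun g => (ses M).g.hom (D g)) d'
    (fun g h => by rw [hD, map_add, Rep.hom_comm_apply]) hd' (fun w => by
      by_cases hw : w = v
      · subst hw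
        rw [hDv, hyz]
      · rw [hD0 w hw, hd'0 w hw, map_zero])
  refine ⟨(ses M).g.hom u + z, fun g => ?_⟩
  have h3 := hfin g
  simp only [← hu g, map_sub, Rep.hom_comm_apply, d', p] at h3
  rw [map_add]
  rw [eq_sub_iff_add_eq] at h3
  rw [← h3]
  abel

end Raag

lemma main (n : ℕ) : ∀ (V : Type) [Finite V] (Γ : SimpleGraph V) (m : ℕ),
    Nat.card V = n → (∀ s : Finset V, Γ.IsClique (↑s : Set V) → s.card ≤ m) →
    ∀ (M : Rep ℤ (RAAG Γ)) (k : ℕ), m < k → IsZero (groupCohomology M k) := by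
  classical
  induction n using Nat.strong_induction_on with
  | _ n ih =>
  intro V _ Γ m hcard hmax M k hk
  rcases isEmpty_or_nonempty V with hV | ⟨⟨v⟩⟩
  · obtain ⟨k, rfl⟩ : ∃ j, k = j + 1 := ⟨k - 1, by omega⟩
    have : Subsingleton (RAAG Γ) := subsingleton_of_forall_eq 1 fun g =>
      Subgroup.mem_bot.1 (mem_of_gen Γ ⊥ (fun w => (hV.false w).elim) g)
    exact isZero_groupCohomology_succ_of_subsingleton M k
  · have hm : 1 ≤ m := by simpa using hmax {v} (by simp)
    obtain ⟨k, rfl⟩ : ∃ j, k = j + 2 := ⟨k - 2, by omega⟩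
    have card_lt : ∀ S : Set V, v ∉ S → Nat.card S < n := fun S hS => by
      rw [← hcard]
      have := Fintype.ofFinite V
      rw [Nat.card_eq_fintype_card, Nat.card_eq_fintype_card]
      exact Fintype.card_subtype_lt hS
    have hcl : ∀ (S : Set V) (s : Finset S), (Γ.induce S).IsClique (↑s : Set S) →
        Γ.IsClique (↑(s.map (Function.Embedding.subtype _)) : Set V) := by
      intro S s hs a ha b hb hab
      simp only [Finset.coe_map, Set.mem_image] at ha hb
      obtain ⟨a, ha, rfl⟩ := ha
      obtain ⟨b, hb, rfl⟩ := hb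
      exact hs ha hb (fun h => hab (by rw [h]))
    refine step _ _ (retr_incl Γ {w | w ≠ v}) _ _ (retr_incl Γ {w | Γ.Adj v w}) (base Γ v) k M ?_ ?_
    · refine ih _ (card_lt {w | Γ.Adj v w} (by simp)) _ _ (m - 1) rfl ?_ _ _ (by omega)
      intro s hs
      have h1 := hmax (insert v (s.map (Function.Embedding.subtype _))) (by
        rw [Finset.coe_insert]
        refine (hcl _ s hs).insert ?_
        intro b hb _
        simp only [Finset.coe_map, Set.mem_image] at hb
        obtain ⟨b, hb, rfl⟩ := hb
        exact b.2)
      rw [Finset.card_insert_of_notMem (by simp), Finset.card_map] at h1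
      omega
    · refine ih _ (card_lt {w | w ≠ v} (by simp)) _ _ m rfl ?_ _ _ hk
      intro s hs
      simpa using hmax _ (hcl _ s hs)

end RaagCohom

open CategoryTheory Limits in
/-- If the finite simple graph `Γ` has clique number `m`, then the cohomological
dimension of `A_Γ` is at most `m`: for every `ℤ`-linear representation `M` of `A_Γ`
and every `k > m`, the group cohomology `H^k(A_Γ; M)` vanishes. -/
theorem raag_cohomology_vanishes_above_cliqueNum {V : Type} [Fintype V]
    (Γ : SimpleGraph V) (m : ℕ)
    (hclique : ∃ s : Finset V, Γ.IsNClique m s)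
    (hmax : ∀ s : Finset V, Γ.IsClique (↑s : Set V) → s.card ≤ m)
    (M : Rep ℤ (RAAG Γ)) (k : ℕ) (hk : m < k) :
    IsZero (groupCohomology M k) :=
  RaagCohom.main _ V Γ m rfl hmax M k hk
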